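/- Fix n ≥ 2, positive integers K < P, and α ∈ [0,1] with p(θ,α) = α(1 − q(θ)) < 1. Let η_{12}(θ) be the indicator of the event K_1(θ) ∩ K_2(θ) ≠ ∅, set Z̃(θ,α) = α²·(v(θ; |K_1(θ) ∪ K_2(θ)|) − q(θ)²)/(1 − p(θ,α))², and define R_n(θ,α) = E[(1 − α η_{12}(θ))(1 + Z̃(θ,α))^{n−2}]. Then R_n(θ,α) ≤ q(θ) + (1 − q(θ))·exp((n−2)·α q(θ) p(θ,α)/(1 − p(θ,α))²). -/

import Mathlib

open Filter Finset

noncomputable section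

/-- Key rings: `K`-element subsets of a pool `{1,…,P}` of keys. -/
abbrev KeyRing (P K : ℕ) : Type := {S : Finset (Fin P) // S.card = K}

/-- The number `C(P,K)` of possible key rings; each key ring has probability
`(numKR P K)⁻¹` under the uniform distribution. -/
def numKR (P K : ℕ) : ℝ := (P.choose K : ℝ)

/-- `q(θ) = C(P−K,K)/C(P,K)` if `2K ≤ P`, and `0` otherwise. -/
def q (K P : ℕ) : ℝ :=
  if 2 * K ≤ P then ((P - K).choose K : ℝ) / (P.choose K : ℝ) else 0

/-- `v(θ;r) = C(P−r,K)/C(P,K)` if `r ≤ P−K`, and `0` otherwise. -/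
def v (K P r : ℕ) : ℝ :=
  if r ≤ P - K then ((P - r).choose K : ℝ) / (P.choose K : ℝ) else 0

theorem aux_desc (m d k : ℕ) :
    m.descFactorial k * (m + 2 * d).descFactorial k ≤ (m + d).descFactorial k ^ 2 := by
  induction k with
  | zero => simp
  | succ k ih =>
    simp only [Nat.descFactorial_succ]
    have h : (m - k) * (m + 2 * d - k) ≤ (m + d - k) ^ 2 := by
      rcases Nat.le_total m k with h | h
      · simp [Nat.sub_eq_zero_of_le h]
      · obtain ⟨c, rfl⟩ := Nat.exists_eq_add_of_le h
        have e1 : k + c - k = c := by omega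
        have e2 : k + c + 2 * d - k = c + 2 * d := by omega
        have e3 : k + c + d - k = c + d := by omega
        rw [e1, e2, e3]; nlinarith [Nat.zero_le (d * d)]
    calc _ = ((m - k) * (m + 2 * d - k)) *
          (m.descFactorial k * (m + 2 * d).descFactorial k) := by ring
      _ ≤ (m + d - k) ^ 2 * (m + d).descFactorial k ^ 2 := Nat.mul_le_mul h ih
      _ = _ := by ring

theorem aux_choose (m d k : ℕ) :
    m.choose k * (m + 2 * d).choose k ≤ (m + d).choose k ^ 2 := by
  have h := aux_desc m d k
  simp only [Nat.descFactorial_eq_factorial_mul_choose] at h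
  have hk : 0 < k.factorial ^ 2 := by positivity
  apply Nat.le_of_mul_le_mul_left _ hk
  nlinarith [h]

theorem aux_q (K P : ℕ) (hKP : K < P) :
    q K P = ((P - K).choose K : ℝ) / (P.choose K : ℝ) := by
  unfold q
  split_ifs with h
  · rfl
  · rw [Nat.choose_eq_zero_of_lt (by omega)]; simp

theorem aux_v_nonneg (K P r : ℕ) : 0 ≤ v K P r := by
  unfold v; split_ifs <;> positivity

theorem aux_v_le (K P r : ℕ) (hKP : K < P) (hr : K ≤ r) : v K P r ≤ q K P := by
  rw [aux_q K P hKP]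
  unfold v
  split_ifs
  · gcongr
  · positivity

theorem aux_v_two (K P : ℕ) (hKP : K < P) : v K P (2 * K) ≤ q K P ^ 2 := by
  rw [aux_q K P hKP]
  unfold v
  split_ifs with h
  · have hc := aux_choose (P - 2 * K) K K
    rw [show P - 2 * K + 2 * K = P by omega, show P - 2 * K + K = P - K by omega] at hc
    have hN : (0 : ℝ) < P.choose K := by exact_mod_cast Nat.choose_pos hKP.le
    have hc' : ((P - 2 * K).choose K : ℝ) * (P.choose K) ≤ ((P - K).choose K : ℝ) ^ 2 := by
      exact_mod_cast hc
    rw [div_pow, div_le_div_iff₀ hN (by positivity)]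
    nlinarith
  · positivity

theorem aux_count (K P : ℕ) (S : KeyRing P K) (E : ℝ) :
    ∑ T : KeyRing P K, (if (S.1 ∩ T.1).Nonempty then E else 1)
      = ((P.choose K : ℝ) - (P - K).choose K) * E + (P - K).choose K := by
  have h0 : ∑ T : KeyRing P K, (if (S.1 ∩ T.1).Nonempty then E else 1)
      = ∑ T ∈ powersetCard K (univ : Finset (Fin P)),
          (if (S.1 ∩ T).Nonempty then E else 1) := by
    symm
    apply Finset.sum_subtype
    intro x; simp [mem_powersetCard]
  have h1 : ∑ T ∈ powersetCard K (univ : Finset (Fin P)),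
      (if (S.1 ∩ T).Nonempty then E else 1)
      = ∑ T ∈ powersetCard K (univ : Finset (Fin P)),
        (E + (if ¬ (S.1 ∩ T).Nonempty then 1 - E else 0)) := by
    apply sum_congr rfl
    intro T _
    by_cases h : (S.1 ∩ T).Nonempty <;> simp [h]
  have h2 : (powersetCard K (univ : Finset (Fin P))).filter (fun T => ¬ (S.1 ∩ T).Nonempty)
      = powersetCard K (S.1ᶜ) := by
    ext T
    simp only [mem_filter, mem_powersetCard, subset_univ, true_and, not_nonempty_iff_eq_empty,
      ← disjoint_iff_inter_eq_empty, subset_compl_iff_disjoint_left]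
    tauto
  rw [h0, h1, sum_add_distrib, ← sum_filter, h2]
  simp [card_compl, S.2]
  ring

/-- With `p(θ,α) = α(1-q(θ)) < 1`, `η_{12}` the indicator of `K_1(θ) ∩ K_2(θ) ≠ ∅`,
`Z̃(θ,α) = α² (v(θ;|K_1(θ) ∪ K_2(θ)|) - q(θ)²)/(1-p(θ,α))²`, and
`R_n(θ,α) = E[(1 - α η_{12})(1+Z̃)^{n-2}]`:
`R_n(θ,α) ≤ q(θ) + (1-q(θ)) exp((n-2) α q(θ) p(θ,α)/(1-p(θ,α))²)`. -/
theorem key_bound_on_R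
    (n K P : ℕ) (α : ℝ) (hn : 2 ≤ n) (hK : 0 < K) (hKP : K < P)
    (hα : 0 ≤ α ∧ α ≤ 1) (hp : α * (1 - q K P) < 1) :
    (∑ S₁ : KeyRing P K, ∑ S₂ : KeyRing P K,
        (numKR P K)⁻¹ * (numKR P K)⁻¹ *
          ((1 - α * (if (S₁.1 ∩ S₂.1).Nonempty then (1 : ℝ) else 0)) *
            (1 + α ^ 2 * (v K P (S₁.1 ∪ S₂.1).card - q K P ^ 2)
                / (1 - α * (1 - q K P)) ^ 2) ^ (n - 2)))
      ≤ q K P + (1 - q K P) *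
          Real.exp (((n : ℝ) - 2) * (α * q K P * (α * (1 - q K P)))
              / (1 - α * (1 - q K P)) ^ 2) := by
  obtain ⟨hα0, hα1⟩ := hα
  have hN : (0 : ℝ) < P.choose K := by exact_mod_cast Nat.choose_pos hKP.le
  have hq := aux_q K P hKP
  have hq0 : 0 ≤ q K P := by rw [hq]; positivity
  have hq1 : q K P ≤ 1 := by
    rw [hq, div_le_one hN]
    exact_mod_cast Nat.choose_le_choose K (Nat.sub_le P K)
  set Q := q K P with hQ
  have hd : 0 < 1 - α * (1 - Q) := by linarith
  set D := 1 - α * (1 - Q) with hD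
  have hD2 : 0 < D ^ 2 := by positivity
  set X := ((n : ℝ) - 2) * (α * Q * (α * (1 - Q))) / D ^ 2 with hX
  have hterm : ∀ S₁ S₂ : KeyRing P K,
      (1 - α * (if (S₁.1 ∩ S₂.1).Nonempty then (1 : ℝ) else 0)) *
            (1 + α ^ 2 * (v K P (S₁.1 ∪ S₂.1).card - Q ^ 2) / D ^ 2) ^ (n - 2)
        ≤ if (S₁.1 ∩ S₂.1).Nonempty then Real.exp X else 1 := by
    intro S T
    have hv0 := aux_v_nonneg K P (S.1 ∪ T.1).card
    have hbase : 0 ≤ 1 + α ^ 2 * (v K P (S.1 ∪ T.1).card - Q ^ 2) / D ^ 2 := by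
      have h1 : (α * Q) ^ 2 ≤ D ^ 2 := by
        apply pow_le_pow_left₀ (by positivity)
        rw [hD]; linarith
      have h2 : -1 ≤ α ^ 2 * (v K P (S.1 ∪ T.1).card - Q ^ 2) / D ^ 2 := by
        rw [le_div_iff₀ hD2]
        nlinarith [mul_nonneg (sq_nonneg α) hv0]
      linarith
    split_ifs with h
    · have hv := aux_v_le K P (S.1 ∪ T.1).card hKP
        (S.2.symm.le.trans (card_le_card subset_union_left))
      rw [← hQ] at hv
      have h1 : 1 + α ^ 2 * (v K P (S.1 ∪ T.1).card - Q ^ 2) / D ^ 2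
          ≤ Real.exp (α * Q * (α * (1 - Q)) / D ^ 2) := by
        refine le_trans ?_ (Real.add_one_le_exp _)
        rw [add_comm]
        apply add_le_add_left
        apply div_le_div_of_nonneg_right _ hD2.le
        nlinarith [mul_le_mul_of_nonneg_left hv (sq_nonneg α)]
      have h2 := pow_le_pow_left₀ hbase h1 (n - 2)
      rw [← Real.exp_nat_mul, Nat.cast_sub hn] at h2
      have h3 : ((n : ℝ) - (2 : ℕ)) * (α * Q * (α * (1 - Q)) / D ^ 2) = X := by
        rw [hX]; push_cast; ring
      rw [h3] at h2
      refine le_trans ?_ h2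
      apply mul_le_of_le_one_left (pow_nonneg hbase _)
      linarith
    · have hcard : (S.1 ∪ T.1).card = 2 * K := by
        rw [card_union_of_disjoint, S.2, T.2, two_mul]
        rw [disjoint_iff_inter_eq_empty]
        exact not_nonempty_iff_eq_empty.mp h
      have hv := aux_v_two K P hKP
      rw [← hQ, ← hcard] at hv
      simp only [mul_zero, sub_zero, one_mul]
      apply pow_le_one₀ hbase
      have : α ^ 2 * (v K P (S.1 ∪ T.1).card - Q ^ 2) / D ^ 2 ≤ 0 := by
        apply div_nonpos_of_nonpos_of_nonneg _ hD2.le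
        exact mul_nonpos_of_nonneg_of_nonpos (sq_nonneg α) (by linarith)
      linarith
  have hNpos : 0 < numKR P K := hN
  calc _ ≤ ∑ S₁ : KeyRing P K, ∑ S₂ : KeyRing P K, (numKR P K)⁻¹ * (numKR P K)⁻¹ *
        (if (S₁.1 ∩ S₂.1).Nonempty then Real.exp X else 1) := by
        apply sum_le_sum; intro S _
        apply sum_le_sum; intro T _
        exact mul_le_mul_of_nonneg_left (hterm S T) (by positivity)
    _ = Q + (1 - Q) * Real.exp X := by
        simp only [← mul_sum, aux_count]
        have hc : Fintype.card (KeyRing P K) = P.choose K := by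
          simp
        rw [sum_const, card_univ, hc, nsmul_eq_mul, hq]
        unfold numKR
        field_simp
        ring
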